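/- arXiv:1906.04911 — 10 statements merged into one kernel-verified Lean document; each statement's English description precedes it below -/
import Mathlib

section
/- Let a,b be positive reals. For every real λ with λ ≠ a and λ ≠ −b, each of the four lines x+y = √(a+b), x+y = −√(a+b), x−y = √(a+b), x−y = −√(a+b) intersects the conic C_λ : x²/(a−λ) + y²/(b+λ) = 1 in exactly one point (x,y) ∈ ℝ²; that is, these four lines are tangent to every nondegenerate conic of the confocal family. -/
/-- If `A + B = s²`, the line `x + e y = s` with `e = ±1` meets the conic `x²/A + y²/B = 1`
only at `(A / s, e B / s)`. -/
theorem existsUnique_mem_line_conic {A B s e : ℝ} (hA : A ≠ 0) (hB : B ≠ 0) (hs : s ≠ 0)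
    (he : e ^ 2 = 1) (hAB : A + B = s ^ 2) :
    ∃! p : ℝ × ℝ, p.1 + e * p.2 = s ∧ p.1 ^ 2 / A + p.2 ^ 2 / B = 1 := by
  refine ⟨(A / s, e * B / s), ⟨?_, ?_⟩, ?_⟩
  · field_simp
    linear_combination hAB + B * he
  · field_simp
    linear_combination hAB + B * he
  · rintro ⟨x, y⟩ ⟨hline, hconic⟩
    dsimp only at hline hconic
    field_simp at hconic
    have hy : y = e * (s - x) := by linear_combination e * hline - y * he
    have hx : s * x - A = 0 := by
      refine pow_eq_zero_iff two_ne_zero |>.mp ?_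
      subst hy
      linear_combination hconic - A * (s - x) ^ 2 * he - (x ^ 2 + A) * hAB + 2 * A * hAB
    have hx' : x = A / s := by
      field_simp
      linear_combination hx
    refine Prod.ext hx' ?_
    dsimp only
    rw [hy, hx']
    field_simp
    linear_combination -e * hAB

/-- Each of the four distinguished lines is tangent to (meets in exactly one point)
every nondegenerate conic `C_λ : x²/(a−λ) + y²/(b+λ) = 1` of the confocal family. -/
theorem stmt_0 (a b lam : ℝ) (ha : 0 < a) (hb : 0 < b)
    (h1 : lam ≠ a) (h2 : lam ≠ -b) :
    (∃! p : ℝ × ℝ, p.1 + p.2 = Real.sqrt (a + b) ∧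
      p.1 ^ 2 / (a - lam) + p.2 ^ 2 / (b + lam) = 1) ∧
    (∃! p : ℝ × ℝ, p.1 + p.2 = -Real.sqrt (a + b) ∧
      p.1 ^ 2 / (a - lam) + p.2 ^ 2 / (b + lam) = 1) ∧
    (∃! p : ℝ × ℝ, p.1 - p.2 = Real.sqrt (a + b) ∧
      p.1 ^ 2 / (a - lam) + p.2 ^ 2 / (b + lam) = 1) ∧
    (∃! p : ℝ × ℝ, p.1 - p.2 = -Real.sqrt (a + b) ∧
      p.1 ^ 2 / (a - lam) + p.2 ^ 2 / (b + lam) = 1) := by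
  have hA : a - lam ≠ 0 := sub_ne_zero.mpr h1.symm
  have hB : b + lam ≠ 0 := fun h => h2 (by linear_combination h)
  have hs : Real.sqrt (a + b) ≠ 0 := (Real.sqrt_pos.mpr (add_pos ha hb)).ne'
  have hAB : a - lam + (b + lam) = Real.sqrt (a + b) ^ 2 := by
    rw [Real.sq_sqrt (add_pos ha hb).le]
    ring
  have hAB' : a - lam + (b + lam) = (-Real.sqrt (a + b)) ^ 2 := by rw [hAB, neg_sq]
  refine ⟨?_, ?_, ?_, ?_⟩
  · simpa using existsUnique_mem_line_conic hA hB hs (one_pow 2) hAB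
  · simpa using existsUnique_mem_line_conic hA hB (neg_ne_zero.mpr hs) (one_pow 2) hAB'
  · simpa only [neg_one_mul, ← sub_eq_add_neg] using
      existsUnique_mem_line_conic hA hB hs neg_one_sq hAB
  · simpa only [neg_one_mul, ← sub_eq_add_neg] using
      existsUnique_mem_line_conic hA hB (neg_ne_zero.mpr hs) neg_one_sq hAB'
end

section
/- Let a,b be positive reals and set γ₁ = (ab/(a+b)²)·(a−b+2√(a²+ab+b²)) and γ₂ = −(ab/(a+b)²)·(b−a+2√(a²+ab+b²)). Then the set of real solutions γ of the equation 3a²b² + 2ab(a−b)γ − (a+b)²γ² = 0 is exactly {γ₁, γ₂}, and moreover −b < γ₂ < 0 < γ₁ < a. -/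
/-- If `s > 0` and `s² = a² + ab + b²`, then `ab (a - b + 2s) / (a + b)²` lies strictly between
`0` and `a`. -/
theorem cayleyRoot_mem_Ioo {a b s : ℝ} (ha : 0 < a) (hb : 0 < b) (hs : 0 < s)
    (hsq : s ^ 2 = a ^ 2 + a * b + b ^ 2) :
    a * b / (a + b) ^ 2 * (a - b + 2 * s) ∈ Set.Ioo 0 a := by
  have hbs : b < s := by
    have := mul_pos ha hb
    nlinarith
  refine ⟨mul_pos (by positivity) (by linarith), ?_⟩
  rw [div_mul_eq_mul_div, div_lt_iff₀ (by positivity), mul_assoc]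
  refine mul_lt_mul_of_pos_left ?_ ha
  nlinarith [pow_pos (sub_pos.2 hbs) 2]

/-- The quadratic in the Cayley condition, factored over its two roots. -/
theorem cayley_factorization {a b s : ℝ} (hab : a + b ≠ 0)
    (hsq : s ^ 2 = a ^ 2 + a * b + b ^ 2) (γ : ℝ) :
    3 * a ^ 2 * b ^ 2 + 2 * a * b * (a - b) * γ - (a + b) ^ 2 * γ ^ 2 =
      -(a + b) ^ 2 * ((γ - a * b / (a + b) ^ 2 * (a - b + 2 * s)) *
        (γ - -(a * b / (a + b) ^ 2 * (b - a + 2 * s)))) := by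
  field_simp
  linear_combination (-4 * a ^ 2 * b ^ 2) * hsq

/-- The Cayley condition for 3-periodic billiard trajectories: the real solutions
of `3a²b² + 2ab(a−b)γ − (a+b)²γ² = 0` are exactly `γ₁` and `γ₂`, with
`−b < γ₂ < 0 < γ₁ < a`. -/
theorem stmt_1 (a b : ℝ) (ha : 0 < a) (hb : 0 < b) :
    (∀ γ : ℝ,
      3 * a ^ 2 * b ^ 2 + 2 * a * b * (a - b) * γ - (a + b) ^ 2 * γ ^ 2 = 0 ↔
        γ = a * b / (a + b) ^ 2 * (a - b + 2 * Real.sqrt (a ^ 2 + a * b + b ^ 2)) ∨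
        γ = -(a * b / (a + b) ^ 2 * (b - a + 2 * Real.sqrt (a ^ 2 + a * b + b ^ 2)))) ∧
    -b < -(a * b / (a + b) ^ 2 * (b - a + 2 * Real.sqrt (a ^ 2 + a * b + b ^ 2))) ∧
    -(a * b / (a + b) ^ 2 * (b - a + 2 * Real.sqrt (a ^ 2 + a * b + b ^ 2))) < 0 ∧
    (0 : ℝ) < a * b / (a + b) ^ 2 * (a - b + 2 * Real.sqrt (a ^ 2 + a * b + b ^ 2)) ∧
    a * b / (a + b) ^ 2 * (a - b + 2 * Real.sqrt (a ^ 2 + a * b + b ^ 2)) < a := by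
  have hs : 0 < Real.sqrt (a ^ 2 + a * b + b ^ 2) := Real.sqrt_pos.2 (by positivity)
  have hsq : Real.sqrt (a ^ 2 + a * b + b ^ 2) ^ 2 = a ^ 2 + a * b + b ^ 2 :=
    Real.sq_sqrt (by positivity)
  generalize Real.sqrt (a ^ 2 + a * b + b ^ 2) = s at hs hsq ⊢
  have hab : a + b ≠ 0 := by positivity
  obtain ⟨h₁, h₂⟩ := cayleyRoot_mem_Ioo ha hb hs hsq
  obtain ⟨h₃, h₄⟩ := cayleyRoot_mem_Ioo hb ha hs (by linarith)
  rw [mul_comm b a, add_comm b a] at h₃ h₄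
  refine ⟨fun γ => ?_, neg_lt_neg h₄, neg_lt_zero.2 h₃, h₁, h₂⟩
  rw [cayley_factorization hab hsq, mul_eq_zero_iff_left (neg_ne_zero.2 (pow_ne_zero 2 hab)),
    mul_eq_zero, sub_eq_zero, sub_eq_zero]
end

section
/- Let a,b,γ be positive reals. The function f(x) = √((a−x)(b+x)(γ−x))/(γ−x) is smooth on a neighborhood of x = 0, and its second Taylor coefficient at 0 satisfies f''(0)/2 = (3a²b² + 2ab(a−b)γ − (a+b)²γ²) / (8(ab)^{3/2} γ^{5/2}). -/
/-- The first derivative of `√((a−x)(b+x)(γ−x))/(γ−x)`, in logarithmic form. -/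
theorem hasDerivAt_sqrt_cubic_div {a b γ x : ℝ} (ha : 0 < a - x) (hb : 0 < b + x)
    (hγ : 0 < γ - x) :
    HasDerivAt (fun x : ℝ => Real.sqrt ((a - x) * (b + x) * (γ - x)) / (γ - x))
      (Real.sqrt ((a - x) * (b + x) * (γ - x)) / (γ - x) *
        ((-(a - x)⁻¹ + (b + x)⁻¹ + (γ - x)⁻¹) / 2)) x := by
  have hp : 0 < (a - x) * (b + x) * (γ - x) := by positivity
  have hA : HasDerivAt (fun x : ℝ => a - x) (-1) x := (hasDerivAt_id x).const_sub a
  have hB : HasDerivAt (fun x : ℝ => b + x) 1 x := (hasDerivAt_id x).const_add b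
  have hC : HasDerivAt (fun x : ℝ => γ - x) (-1) x := (hasDerivAt_id x).const_sub γ
  have h := (((hA.fun_mul hB).fun_mul hC).sqrt hp.ne').fun_div hC hγ.ne'
  refine h.congr_deriv ?_
  have hs : 0 < Real.sqrt ((a - x) * (b + x) * (γ - x)) := Real.sqrt_pos.2 hp
  have hsq := Real.sq_sqrt hp.le
  generalize Real.sqrt ((a - x) * (b + x) * (γ - x)) = s at hs hsq ⊢
  generalize a - x = A at *
  generalize b + x = B at *
  generalize γ - x = C at *
  field_simp
  rw [hsq]
  ring

/-- The coefficient `C₂` of the Taylor expansion of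
`√((a−x)(b+x)(γ−x))/(γ−x)` around `x = 0`. -/
theorem stmt_2 (a b γ : ℝ) (ha : 0 < a) (hb : 0 < b) (hγ : 0 < γ) :
    (∃ U ∈ nhds (0 : ℝ), ContDiffOn ℝ (⊤ : ℕ∞)
      (fun x : ℝ => Real.sqrt ((a - x) * (b + x) * (γ - x)) / (γ - x)) U) ∧
    iteratedDeriv 2
        (fun x : ℝ => Real.sqrt ((a - x) * (b + x) * (γ - x)) / (γ - x)) 0 / 2 =
      (3 * a ^ 2 * b ^ 2 + 2 * a * b * (a - b) * γ - (a + b) ^ 2 * γ ^ 2) /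
        (8 * (a * b) ^ ((3 : ℝ) / 2) * γ ^ ((5 : ℝ) / 2)) := by
  have hU : ∀ᶠ x in nhds (0 : ℝ), 0 < a - x ∧ 0 < b + x ∧ 0 < γ - x := by
    filter_upwards [Iio_mem_nhds ha, Ioi_mem_nhds (neg_lt_zero.2 hb), Iio_mem_nhds hγ]
      with x h₁ h₂ h₃
    simp only [Set.mem_Iio, Set.mem_Ioi] at h₁ h₂ h₃
    exact ⟨by linarith, by linarith, by linarith⟩
  refine ⟨⟨_, hU, ?_⟩, ?_⟩
  · refine ContDiffOn.div (ContDiffOn.sqrt (by fun_prop) ?_) (by fun_prop) ?_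
    · rintro x ⟨h₁, h₂, h₃⟩
      positivity
    · rintro x ⟨-, -, h₃⟩
      exact h₃.ne'
  · have hderiv := hU.mono fun x hx => (hasDerivAt_sqrt_cubic_div hx.1 hx.2.1 hx.2.2).deriv
    have hA : HasDerivAt (fun x : ℝ => (a - x)⁻¹) _ 0 :=
      ((hasDerivAt_id (0 : ℝ)).const_sub a).fun_inv (by simpa using ha.ne')
    have hB : HasDerivAt (fun x : ℝ => (b + x)⁻¹) _ 0 :=
      ((hasDerivAt_id (0 : ℝ)).const_add b).fun_inv (by simpa using hb.ne')
    have hC : HasDerivAt (fun x : ℝ => (γ - x)⁻¹) _ 0 :=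
      ((hasDerivAt_id (0 : ℝ)).const_sub γ).fun_inv (by simpa using hγ.ne')
    have hf := hasDerivAt_sqrt_cubic_div (a := a) (b := b) (γ := γ) (x := 0)
      (by simpa) (by simpa) (by simpa)
    have hg := hf.fun_mul (((hA.fun_neg.fun_add hB).fun_add hC).div_const 2)
    rw [iteratedDeriv_succ, iteratedDeriv_one, Filter.EventuallyEq.deriv_eq hderiv, hg.deriv]
    have hab : 0 < a * b := mul_pos ha hb
    have h₁ : (a * b) ^ ((3 : ℝ) / 2) = a * b * Real.sqrt (a * b) := by
      rw [show (3 : ℝ) / 2 = 1 + 1 / 2 by norm_num, Real.rpow_add hab, Real.rpow_one,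
        Real.sqrt_eq_rpow]
    have h₂ : γ ^ ((5 : ℝ) / 2) = γ ^ 2 * Real.sqrt γ := by
      rw [show (5 : ℝ) / 2 = 2 + 1 / 2 by norm_num, Real.rpow_add hγ, Real.rpow_two,
        Real.sqrt_eq_rpow]
    rw [h₁, h₂]
    simp only [id, sub_zero, add_zero, Real.sqrt_mul hab.le]
    have hu := Real.sq_sqrt hab.le
    have hv := Real.sq_sqrt hγ.le
    have hu₀ := Real.sqrt_pos.2 hab
    have hv₀ := Real.sqrt_pos.2 hγ
    generalize Real.sqrt (a * b) = u at *
    generalize Real.sqrt γ = v at *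
    field_simp
    rw [hu, hv]
    ring
end

section
/- Let a,b,γ be positive reals. The function g(x) = √((a−x)(b+x)(γ−x)) is smooth on a neighborhood of x = 0, and its third Taylor coefficient at 0 satisfies g'''(0)/6 = −(ab+aγ+bγ)(ab+aγ−bγ)(ab−aγ−bγ) / (16(abγ)^{5/2}). -/
open scoped Topology

/-- Successive derivatives on a neighbourhood compute the third iterated derivative. -/
theorem iteratedDeriv_three_of_eventually_hasDerivAt {f f₁ f₂ : ℝ → ℝ} {d x : ℝ}
    (h₁ : ∀ᶠ y in 𝓝 x, HasDerivAt f (f₁ y) y) (h₂ : ∀ᶠ y in 𝓝 x, HasDerivAt f₁ (f₂ y) y)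
    (h₃ : HasDerivAt f₂ d x) : iteratedDeriv 3 f x = d := by
  have e₁ : deriv f =ᶠ[𝓝 x] f₁ := h₁.mono fun y hy => hy.deriv
  have e₂ : deriv f₁ =ᶠ[𝓝 x] f₂ := h₂.mono fun y hy => hy.deriv
  simp only [iteratedDeriv_succ, iteratedDeriv_zero]
  exact (e₁.deriv.trans e₂).deriv_eq.trans h₃.deriv

/-- The third derivative of `√p` at a point where `p` is positive. -/
theorem iteratedDeriv_three_sqrt {p p₁ p₂ p₃ : ℝ → ℝ} {x : ℝ}
    (h₁ : ∀ y, HasDerivAt p (p₁ y) y) (h₂ : ∀ y, HasDerivAt p₁ (p₂ y) y)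
    (h₃ : ∀ y, HasDerivAt p₂ (p₃ y) y) (hx : 0 < p x) :
    iteratedDeriv 3 (fun y => √(p y)) x =
      (4 * p x ^ 2 * p₃ x - 6 * p x * p₁ x * p₂ x + 3 * p₁ x ^ 3) / (8 * √(p x) ^ 5) := by
  have hpos : ∀ᶠ y in 𝓝 x, 0 < p y := (h₁ x).continuousAt.eventually (lt_mem_nhds hx)
  have hs : ∀ y, 0 < p y → HasDerivAt (fun y => √(p y)) (p₁ y / (2 * √(p y))) y :=
    fun y hy => (h₁ y).sqrt hy.ne'
  refine iteratedDeriv_three_of_eventually_hasDerivAt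
    (f₁ := fun y => p₁ y / (2 * √(p y)))
    (f₂ := fun y => (2 * p y * p₂ y - p₁ y ^ 2) / (4 * √(p y) ^ 3))
    (hpos.mono hs) (hpos.mono fun y hy => ?_) ?_
  · have hr : 0 < √(p y) := Real.sqrt_pos.2 hy
    have hsq : √(p y) ^ 2 = p y := Real.sq_sqrt hy.le
    refine ((h₂ y).fun_div ((hs y hy).const_mul 2) (by positivity)).congr_deriv ?_
    generalize √(p y) = r at *
    rw [← hsq]
    field_simp
    ring
  · have hr : 0 < √(p x) := Real.sqrt_pos.2 hx
    have hsq : √(p x) ^ 2 = p x := Real.sq_sqrt hx.le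
    refine (((((h₁ x).const_mul 2).fun_mul (h₃ x)).fun_sub ((h₂ x).fun_pow 2)).fun_div
      (((hs x hx).fun_pow 3).const_mul 4) (by positivity)).congr_deriv ?_
    generalize √(p x) = r at *
    rw [← hsq]
    field_simp
    ring


/-- The coefficient `B₃` of the Taylor expansion of
`√((a−x)(b+x)(γ−x))` around `x = 0`. -/
theorem stmt_3 (a b γ : ℝ) (ha : 0 < a) (hb : 0 < b) (hγ : 0 < γ) :
    (∃ U ∈ nhds (0 : ℝ), ContDiffOn ℝ (⊤ : ℕ∞)
      (fun x : ℝ => Real.sqrt ((a - x) * (b + x) * (γ - x))) U) ∧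
    iteratedDeriv 3
        (fun x : ℝ => Real.sqrt ((a - x) * (b + x) * (γ - x))) 0 / 6 =
      -((a * b + a * γ + b * γ) * (a * b + a * γ - b * γ) * (a * b - a * γ - b * γ)) /
        (16 * (a * b * γ) ^ ((5 : ℝ) / 2)) := by
  have h₀ : 0 < a * b * γ := by positivity
  constructor
  · refine ⟨{x | 0 < (a - x) * (b + x) * (γ - x)}, ?_, ?_⟩
    · refine (isOpen_lt continuous_const (by fun_prop)).mem_nhds ?_
      simpa using h₀
    · exact ContDiffOn.sqrt (by fun_prop) fun x hx => ne_of_gt hx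
  · have h₁ : ∀ y, HasDerivAt (fun x : ℝ => (a - x) * (b + x) * (γ - x))
        (a * γ - b * γ - a * b + 2 * (b - a - γ) * y + 3 * y ^ 2) y := fun y =>
      (((((hasDerivAt_id' y).const_sub a).fun_mul ((hasDerivAt_id' y).const_add b)).fun_mul
        ((hasDerivAt_id' y).const_sub γ))).congr_deriv (by ring)
    have h₂ : ∀ y, HasDerivAt
        (fun y : ℝ => a * γ - b * γ - a * b + 2 * (b - a - γ) * y + 3 * y ^ 2)
        (2 * (b - a - γ) + 6 * y) y := fun y =>
      ((((hasDerivAt_id' y).const_mul (2 * (b - a - γ))).const_add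
        (a * γ - b * γ - a * b)).fun_add
          (((hasDerivAt_id' y).fun_pow 2).const_mul 3)).congr_deriv (by norm_num; ring)
    have h₃ : ∀ y, HasDerivAt (fun y : ℝ => 2 * (b - a - γ) + 6 * y) 6 y := fun y =>
      (((hasDerivAt_id' y).const_mul 6).const_add (2 * (b - a - γ))).congr_deriv (by ring)
    have hpow : (a * b * γ) ^ ((5 : ℝ) / 2) = √(a * b * γ) ^ 5 := by
      rw [Real.sqrt_eq_rpow, ← Real.rpow_mul_natCast h₀.le]
      norm_num
    have hr : 0 < √(a * b * γ) := Real.sqrt_pos.2 h₀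
    rw [iteratedDeriv_three_sqrt h₁ h₂ h₃ (by simpa using h₀), hpow]
    simp only [sub_zero, add_zero]
    field_simp
    ring
end

section
/- Let a,b be positive reals. The discriminant of the quadratic (a+b)²γ² + 2ab(a−b)γ + a²b² (in the variable γ) equals −16a³b³, which is negative; consequently (a+b)²γ² + 2ab(a−b)γ + a²b² > 0 for every real γ. -/
/-- The quadratic `(a+b)²γ² + 2ab(a−b)γ + a²b²` has discriminant `−16a³b³ < 0`,
hence it is positive for every real `γ`. -/
theorem stmt_5 (a b : ℝ) (ha : 0 < a) (hb : 0 < b) :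
    discrim ((a + b) ^ 2) (2 * a * b * (a - b)) (a ^ 2 * b ^ 2) =
      -16 * a ^ 3 * b ^ 3 ∧
    -16 * a ^ 3 * b ^ 3 < 0 ∧
    ∀ γ : ℝ, 0 < (a + b) ^ 2 * γ ^ 2 + 2 * a * b * (a - b) * γ + a ^ 2 * b ^ 2 := by
  have hab : 0 < a ^ 3 * b ^ 3 := by positivity
  refine ⟨by unfold discrim; ring, by linarith, fun γ => ?_⟩
  have hs : 0 < (a + b) ^ 2 := by positivity
  refine pos_of_mul_pos_right ?_ hs.le
  calc 0 < ((a + b) ^ 2 * γ + a * b * (a - b)) ^ 2 + 4 * a ^ 3 * b ^ 3 := by positivity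
    _ = _ := by ring
end

section
/- Let a,b,γ be positive reals. Then: (i) the second Taylor coefficient at x = 0 of x ↦ √((a−x)(b+x)(γ−x))/(b+x) vanishes if and only if −(a+b)(3a−b)γ² − 2ab(a+b)γ + a²b² = 0; (ii) the second Taylor coefficient at x = 0 of x ↦ √((a−x)(b+x)(γ−x))/(a−x) vanishes if and only if (a+b)(a−3b)γ² + 2ab(a+b)γ + a²b² = 0. -/
open Filter Topology in
/-- The second derivative at a point of a function with logarithmic derivative `h` nearby. -/
theorem iteratedDeriv_two_of_logDeriv {f h : ℝ → ℝ} {h' x₀ : ℝ}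
    (hf : ∀ᶠ x in 𝓝 x₀, HasDerivAt f (f x * h x) x) (hh : HasDerivAt h h' x₀) :
    iteratedDeriv 2 f x₀ = f x₀ * (h x₀ ^ 2 + h') := by
  have hd : deriv f =ᶠ[𝓝 x₀] fun x => f x * h x := hf.mono fun x hx => hx.deriv
  rw [iteratedDeriv_succ, iteratedDeriv_one, hd.deriv_eq, (hf.self_of_nhds.fun_mul hh).deriv]
  ring

open Filter Topology in
/-- The second derivative at `0` of the square root of a product of three affine functions
divided by one of them. -/
theorem iteratedDeriv_two_sqrt_mul_affine_div {p q r : ℝ} (α β δ : ℝ)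
    (hp : 0 < p) (hq : 0 < q) (hr : 0 < r) :
    iteratedDeriv 2
        (fun x : ℝ => Real.sqrt ((p + α * x) * (q + β * x) * (r + δ * x)) / (q + β * x)) 0 =
      Real.sqrt (p * q * r) / q *
        (((α / p - β / q + δ / r) / 2) ^ 2 +
          (-(α / p) ^ 2 + (β / q) ^ 2 - (δ / r) ^ 2) / 2) := by
  have affine (c m x : ℝ) : HasDerivAt (fun y : ℝ => c + m * y) m x := by
    simpa using ((hasDerivAt_id x).const_mul m).const_add c
  have pos {c : ℝ} (m : ℝ) (hc : 0 < c) : ∀ᶠ x : ℝ in 𝓝 0, 0 < c + m * x :=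
    (affine c m 0).continuousAt.eventually (lt_mem_nhds (by simpa using hc))
  have quot {c : ℝ} (m : ℝ) (hc : 0 < c) :
      HasDerivAt (fun x : ℝ => m / (c + m * x)) (-(m / c) ^ 2) 0 := by
    refine ((hasDerivAt_const (0 : ℝ) m).fun_div (affine c m 0)
      (by simpa using hc.ne')).congr_deriv ?_
    simp only [mul_zero, add_zero]
    field_simp
    ring
  have key := iteratedDeriv_two_of_logDeriv
    (f := fun x : ℝ => Real.sqrt ((p + α * x) * (q + β * x) * (r + δ * x)) / (q + β * x))
    (h := fun x : ℝ => (α / (p + α * x) - β / (q + β * x) + δ / (r + δ * x)) / 2)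
    (x₀ := 0) ?_ ((((quot α hp).fun_sub (quot β hq)).fun_add (quot δ hr)).div_const 2)
  · rw [key]
    simp only [mul_zero, add_zero]
    ring
  · filter_upwards [pos α hp, pos β hq, pos δ hr] with x hu hv hw
    have hP := mul_pos (mul_pos hu hv) hw
    have hd := ((((affine p α x).fun_mul (affine q β x)).fun_mul (affine r δ x)).sqrt
      hP.ne').fun_div (affine q β x) hv.ne'
    refine hd.congr_deriv ?_
    have hs := Real.sq_sqrt hP.le
    have hs0 := (Real.sqrt_pos.2 hP).ne'
    generalize Real.sqrt ((p + α * x) * (q + β * x) * (r + δ * x)) = s at hs hs0 ⊢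
    generalize p + α * x = u at *
    generalize q + β * x = v at *
    generalize r + δ * x = w at *
    field_simp
    rw [hs]
    ring

/-- The Cayley-type conditions `E₂ = 0` and `D₂ = 0` for 3-elliptic periodic
trajectories are equivalent to the stated quadratic equations in `γ`. -/
theorem stmt_10 (a b γ : ℝ) (ha : 0 < a) (hb : 0 < b) (hγ : 0 < γ) :
    (iteratedDeriv 2
        (fun x : ℝ => Real.sqrt ((a - x) * (b + x) * (γ - x)) / (b + x)) 0 / 2 = 0 ↔
      -((a + b) * (3 * a - b)) * γ ^ 2 - 2 * a * b * (a + b) * γ + a ^ 2 * b ^ 2 = 0) ∧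
    (iteratedDeriv 2
        (fun x : ℝ => Real.sqrt ((a - x) * (b + x) * (γ - x)) / (a - x)) 0 / 2 = 0 ↔
      (a + b) * (a - 3 * b) * γ ^ 2 + 2 * a * b * (a + b) * γ + a ^ 2 * b ^ 2 = 0) := by
  constructor
  · have h := iteratedDeriv_two_sqrt_mul_affine_div (-1) 1 (-1) ha hb hγ
    simp only [neg_one_mul, one_mul, ← sub_eq_add_neg] at h
    have hc : Real.sqrt (a * b * γ) / b / (8 * a ^ 2 * b ^ 2 * γ ^ 2) ≠ 0 := by positivity
    rw [h]
    refine (Eq.congr_left ?_).trans (mul_eq_zero_iff_left (neg_ne_zero.2 hc))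
    field_simp
    ring
  · have h := iteratedDeriv_two_sqrt_mul_affine_div 1 (-1) (-1) hb ha hγ
    simp only [neg_one_mul, one_mul, ← sub_eq_add_neg] at h
    have hc : Real.sqrt (b * a * γ) / a / (8 * a ^ 2 * b ^ 2 * γ ^ 2) ≠ 0 := by positivity
    simp only [mul_comm (a - _) (b + _)]
    rw [h]
    refine (Eq.congr_left ?_).trans (mul_eq_zero_iff_left (neg_ne_zero.2 hc))
    field_simp
    ring
end

section
/- For every positive real t, with s = √(1+t+t²), one has 2 + t + t² − 2s = (s−1)² > 0 and the identity (−2 − t + 2s)/(2 + t + t² − 2s) = (1 − t + 2s)/(1+t)². -/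
/-- With `s = √(1+t+t²)`, one has `2 + t + t² − 2s = (s−1)² > 0` and the two
expressions for the caustic parameter of a 3-periodic trajectory coincide. -/
theorem stmt_14 (t : ℝ) (ht : 0 < t) :
    2 + t + t ^ 2 - 2 * Real.sqrt (1 + t + t ^ 2) =
      (Real.sqrt (1 + t + t ^ 2) - 1) ^ 2 ∧
    0 < (Real.sqrt (1 + t + t ^ 2) - 1) ^ 2 ∧
    (-2 - t + 2 * Real.sqrt (1 + t + t ^ 2)) /
        (2 + t + t ^ 2 - 2 * Real.sqrt (1 + t + t ^ 2)) =
      (1 - t + 2 * Real.sqrt (1 + t + t ^ 2)) / (1 + t) ^ 2 := by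
  have hs : √(1 + t + t ^ 2) ^ 2 = 1 + t + t ^ 2 := Real.sq_sqrt (by positivity)
  have hs_gt : 1 < √(1 + t + t ^ 2) := Real.lt_sqrt_of_sq_lt (by nlinarith)
  generalize √(1 + t + t ^ 2) = s at hs hs_gt ⊢
  have hsq : 2 + t + t ^ 2 - 2 * s = (s - 1) ^ 2 := by linear_combination -hs
  have hpos : 0 < (s - 1) ^ 2 := pow_pos (sub_pos.mpr hs_gt) 2
  refine ⟨hsq, hpos, ?_⟩
  rw [div_eq_div_iff (hsq ▸ hpos.ne') (by positivity)]
  linear_combination 4 * hs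
end

section
/- Let Z be a real number with 1/2 < Z < 1, and set t = (1−Z²)/(2Z−1), α = 2Z² − 4Z + 1, β = 2Z² − 1. Then t > 0, √(1+t+t²) = Z + t, and (α − β)/(β + 1) = −(t − 1 + 2√(1+t+t²))/(1+t)². -/
/-- Akhiezer data for `n = 3`, `m = 2`: with `t = (1−Z²)/(2Z−1)`,
`α = 2Z²−4Z+1`, `β = 2Z²−1`, one has `t > 0`, `√(1+t+t²) = Z + t`, and the caustic
parameter `(α−β)/(β+1)` equals the Cayley value `−(t−1+2√(1+t+t²))/(1+t)²`. -/
theorem stmt_15 (Z : ℝ) (h1 : 1 / 2 < Z) (h2 : Z < 1) :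
    0 < (1 - Z ^ 2) / (2 * Z - 1) ∧
    Real.sqrt (1 + (1 - Z ^ 2) / (2 * Z - 1) + ((1 - Z ^ 2) / (2 * Z - 1)) ^ 2) =
      Z + (1 - Z ^ 2) / (2 * Z - 1) ∧
    ((2 * Z ^ 2 - 4 * Z + 1) - (2 * Z ^ 2 - 1)) / ((2 * Z ^ 2 - 1) + 1) =
      -(((1 - Z ^ 2) / (2 * Z - 1) - 1 +
          2 * Real.sqrt (1 + (1 - Z ^ 2) / (2 * Z - 1) +
            ((1 - Z ^ 2) / (2 * Z - 1)) ^ 2)) /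
        (1 + (1 - Z ^ 2) / (2 * Z - 1)) ^ 2) := by
  have hd : 0 < 2 * Z - 1 := by linarith
  have hd0 : 2 * Z - 1 ≠ 0 := hd.ne'
  have hZ : 0 < Z := by linarith
  have hZ' : 0 < 2 - Z := by linarith
  have ht : 0 < (1 - Z ^ 2) / (2 * Z - 1) := div_pos (by nlinarith) hd
  have hmul : (1 - Z ^ 2) / (2 * Z - 1) * (2 * Z - 1) = 1 - Z ^ 2 := div_mul_cancel₀ _ hd0
  have hsqrt : Real.sqrt (1 + (1 - Z ^ 2) / (2 * Z - 1) + ((1 - Z ^ 2) / (2 * Z - 1)) ^ 2) =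
      Z + (1 - Z ^ 2) / (2 * Z - 1) := by
    rw [Real.sqrt_eq_iff_mul_self_eq (by positivity) (by positivity)]
    linear_combination -hmul
  refine ⟨ht, hsqrt, ?_⟩
  rw [hsqrt]
  have hnum : (1 - Z ^ 2) / (2 * Z - 1) - 1 + 2 * (Z + (1 - Z ^ 2) / (2 * Z - 1)) =
      (2 - Z) ^ 2 / (2 * Z - 1) := by
    rw [eq_div_iff hd0]
    linear_combination 3 * hmul
  have hden : 1 + (1 - Z ^ 2) / (2 * Z - 1) = Z * (2 - Z) / (2 * Z - 1) := by
    rw [eq_div_iff hd0]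
    linear_combination hmul
  rw [hnum, hden, sub_add_cancel]
  field_simp
  ring
end

section
/- Let a,b be positive reals with a ≠ b, let γ = ab/(b−a), and for s ∈ ℝ set u(s) = 2abs² + 2(a−b)s − 1. Then u(s) − 1 = 2ab(s − 1/a)(s + 1/b), u(s) + 1 = 2abs(s − 1/γ), and consequently T₂(u(s))² − s(s − 1/a)(s + 1/b)(s − 1/γ)·(4ab·u(s))² = 1 for all real s, where T₂(x) = 2x² − 1 is the Chebyshev polynomial of the first kind of degree 2. -/
open Polynomial.Chebyshev

/-- The degree-4 extremal polynomial `T₂(2abs² + 2(a−b)s − 1)` solves the Pell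
equation associated with the hyperbolic caustic `γ = ab/(b−a)` of 4-periodic
trajectories. -/
theorem stmt_18 (a b : ℝ) (ha : 0 < a) (hb : 0 < b) (hab : a ≠ b) :
    ∀ s : ℝ,
      (2 * a * b * s ^ 2 + 2 * (a - b) * s - 1) - 1 =
        2 * a * b * ((s - 1 / a) * (s + 1 / b)) ∧
      (2 * a * b * s ^ 2 + 2 * (a - b) * s - 1) + 1 =
        2 * a * b * (s * (s - 1 / (a * b / (b - a)))) ∧
      ((T ℝ 2).eval (2 * a * b * s ^ 2 + 2 * (a - b) * s - 1)) ^ 2 -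
        s * (s - 1 / a) * (s + 1 / b) * (s - 1 / (a * b / (b - a))) *
          (4 * a * b * (2 * a * b * s ^ 2 + 2 * (a - b) * s - 1)) ^ 2 = 1 := by
  intro s
  have ha' : a ≠ 0 := ha.ne'
  have hb' : b ≠ 0 := hb.ne'
  have h₁ : (2 * a * b * s ^ 2 + 2 * (a - b) * s - 1) - 1 =
      2 * a * b * ((s - 1 / a) * (s + 1 / b)) := by
    field_simp
    ring
  have h₂ : (2 * a * b * s ^ 2 + 2 * (a - b) * s - 1) + 1 =
      2 * a * b * (s * (s - 1 / (a * b / (b - a)))) := by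
    field_simp
    ring
  refine ⟨h₁, h₂, ?_⟩
  have hT (x : ℝ) : (T ℝ 2).eval x = 2 * x ^ 2 - 1 := by simp [T_two]
  rw [hT]
  generalize 2 * a * b * s ^ 2 + 2 * (a - b) * s - 1 = u at h₁ h₂ ⊢
  generalize 1 / (a * b / (b - a)) = c at h₂ ⊢
  generalize 1 / a = p at h₁ ⊢
  generalize 1 / b = q at h₁ ⊢
  linear_combination 4 * u ^ 2 * (u + 1) * h₁ +
    4 * u ^ 2 * (2 * a * b * ((s - p) * (s + q))) * h₂
end

section
/- Let a,b be positive reals, let γ = −ab/(a+b), and for s ∈ ℝ set u(s) = (2a²bs² + 2a²s − (a+b))/(a+b). Then u(s) − 1 = (2a²b/(a+b))·(s − 1/a)(s − 1/γ), u(s) + 1 = (2a²b/(a+b))·s(s + 1/b), and consequently T₂(u(s))² − s(s − 1/a)(s + 1/b)(s − 1/γ)·( (4a²b/(a+b))·u(s) )² = 1 for all real s, where T₂(x) = 2x² − 1 is the Chebyshev polynomial of the first kind of degree 2. -/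
open Polynomial.Chebyshev

/-- The degree-4 extremal polynomial `T₂((2a²bs² + 2a²s − (a+b))/(a+b))` solves the
Pell equation associated with the elliptic caustic `γ = −ab/(a+b)` of 4-periodic
trajectories (so that `1/γ = −(a+b)/(ab)`). -/
theorem stmt_19 (a b : ℝ) (ha : 0 < a) (hb : 0 < b) :
    ∀ s : ℝ,
      (2 * a ^ 2 * b * s ^ 2 + 2 * a ^ 2 * s - (a + b)) / (a + b) - 1 =
        (2 * a ^ 2 * b / (a + b)) * ((s - 1 / a) * (s - 1 / (-(a * b / (a + b))))) ∧
      (2 * a ^ 2 * b * s ^ 2 + 2 * a ^ 2 * s - (a + b)) / (a + b) + 1 =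
        (2 * a ^ 2 * b / (a + b)) * (s * (s + 1 / b)) ∧
      ((T ℝ 2).eval ((2 * a ^ 2 * b * s ^ 2 + 2 * a ^ 2 * s - (a + b)) / (a + b))) ^ 2 -
        s * (s - 1 / a) * (s + 1 / b) * (s - 1 / (-(a * b / (a + b)))) *
          ((4 * a ^ 2 * b / (a + b)) *
            ((2 * a ^ 2 * b * s ^ 2 + 2 * a ^ 2 * s - (a + b)) / (a + b))) ^ 2 = 1 := by
  intro s
  have hab : a + b ≠ 0 := (add_pos ha hb).ne'
  have hγ : 1 / (-(a * b / (a + b))) = -((a + b) / (a * b)) := by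
    rw [one_div, inv_neg, inv_div]
  rw [hγ]
  have hsub : (2 * a ^ 2 * b * s ^ 2 + 2 * a ^ 2 * s - (a + b)) / (a + b) - 1 =
      (2 * a ^ 2 * b / (a + b)) * ((s - 1 / a) * (s - -((a + b) / (a * b)))) := by
    field_simp
    ring
  have hadd : (2 * a ^ 2 * b * s ^ 2 + 2 * a ^ 2 * s - (a + b)) / (a + b) + 1 =
      (2 * a ^ 2 * b / (a + b)) * (s * (s + 1 / b)) := by
    field_simp
    ring
  refine ⟨hsub, hadd, ?_⟩
  generalize (2 * a ^ 2 * b * s ^ 2 + 2 * a ^ 2 * s - (a + b)) / (a + b) = u at hsub hadd ⊢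
  have hT : (T ℝ 2).eval u = 2 * u ^ 2 - 1 := by
    simp [T_two]
  rw [hT]
  linear_combination 4 * u ^ 2 * (u + 1) * hsub +
    4 * u ^ 2 * (2 * a ^ 2 * b / (a + b)) * ((s - 1 / a) * (s - -((a + b) / (a * b)))) * hadd
end
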